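/- arXiv:1704.05896 — 2 statements merged into one kernel-verified Lean document; each statement's English description precedes it below -/
import Mathlib

section
/- Let P = (E_P, λ_P) be a solution of the instance (T, 6k−1, 4k), let m ∈ ℕ, and let T' be a partial-T. Then T' cannot satisfy all three of the following conditions simultaneously: (1) the set 𝒯 of those partial-T_i's in T' whose size is at least s − 1 + a_i − 6k and whose partial-R_i is not a P-component has cardinality m; (2) T' contains exactly 2m P-components; (3) T' contains a partial-T_{i₀} not in 𝒯 whose size is at least a_{i₀} + 1 − 6k. -/
namespace TP

/-- Rooted binary trees. -/
inductive RBT : Type where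
  | nil : RBT
  | node : RBT → RBT → RBT

/-- The number of vertices of a rooted binary tree. -/
def RBT.size : RBT → ℕ
  | .nil => 0
  | .node l r => l.size + r.size + 1

/-- A nice binary tree: it has at most one vertex, or its left and right subtrees are
nice binary trees whose numbers of vertices differ by at most 1. -/
def RBT.IsNice : RBT → Prop
  | .nil => True
  | .node l r => l.IsNice ∧ r.IsNice ∧ Nat.dist l.size r.size ≤ 1

/-- Valid positions (vertices) of a rooted binary tree, encoded as lists of booleans:
`false` means "go to the left child", `true` means "go to the right child". -/
def RBT.Valid : RBT → List Bool → Prop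
  | .nil, _ => False
  | .node _ _, [] => True
  | .node l _, (false :: bs) => RBT.Valid l bs
  | .node _ r, (true :: bs) => RBT.Valid r bs

/-- The vertex type of the tree `T` built from the path `H = (p_1, …, p_{3k})` (the `Sum.inl`
part) together with, for each `i`, the binary tree `T_i` with shape `Tsh i` (the `Sum.inr` part,
vertices of `T_i` being its valid positions). -/
abbrev Vtx (k : ℕ) (Tsh : Fin (3*k) → RBT) : Type :=
  Fin (3*k) ⊕ (Σ i : Fin (3*k), {l : List Bool // (Tsh i).Valid l})

/-- The tree `T`: the path `p_1 — p_2 — ⋯ — p_{3k}`, an edge between `p_i` and the root `[]`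
of `T_i` for each `i`, and the parent-child edges inside each binary tree `T_i`. -/
def TGraph (k : ℕ) (Tsh : Fin (3*k) → RBT) : SimpleGraph (Vtx k Tsh) :=
  SimpleGraph.fromRel (fun v w =>
    match v, w with
    | Sum.inl i, Sum.inl j => (i : ℕ) + 1 = (j : ℕ)
    | Sum.inl i, Sum.inr ⟨j, x⟩ => i = j ∧ x.1 = []
    | Sum.inr ⟨i, x⟩, Sum.inr ⟨j, y⟩ => i = j ∧ ∃ c : Bool, y.1 = x.1 ++ [c]
    | _, _ => False)

/-- Combine the shapes of the left subtrees `L_i` and right subtrees `R_i` into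
the shapes of the trees `T_i`. -/
def nodes {ι : Type} (L R : ι → RBT) : ι → RBT := fun i => RBT.node (L i) (R i)

/-- The vertex set of the subtree `T_i`. -/
def TiSet (k : ℕ) (Tsh : Fin (3*k) → RBT) (i : Fin (3*k)) : Set (Vtx k Tsh) :=
  {v | ∃ x : {l : List Bool // (Tsh i).Valid l}, v = Sum.inr ⟨i, x⟩}

/-- The vertex set of the left subtree `L_i` of `T_i` (positions starting with `false`). -/
def LiSet (k : ℕ) (Tsh : Fin (3*k) → RBT) (i : Fin (3*k)) : Set (Vtx k Tsh) :=
  {v | ∃ x : {l : List Bool // (Tsh i).Valid l}, x.1.head? = some false ∧ v = Sum.inr ⟨i, x⟩}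

/-- The vertex set of the right subtree `R_i` of `T_i` (positions starting with `true`). -/
def RiSet (k : ℕ) (Tsh : Fin (3*k) → RBT) (i : Fin (3*k)) : Set (Vtx k Tsh) :=
  {v | ∃ x : {l : List Bool // (Tsh i).Valid l}, x.1.head? = some true ∧ v = Sum.inr ⟨i, x⟩}

/-- A solution `P = (E_P, λ_P)` cutting exactly `kk` edges: `E_P` is a set of exactly `kk`
edges of `G`, and `lam` assigns the connected components of `G − E_P` to `b` groups
(it is constant on each component), so that group `g` receives exactly `sizes g` vertices. -/
def IsSolutionEq {V : Type} (G : SimpleGraph V) (EP : Set (Sym2 V)) (kk b : ℕ)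
    (sizes : Fin b → ℕ) (lam : V → Fin b) : Prop :=
  EP ⊆ G.edgeSet ∧ EP.ncard = kk ∧
    (∀ v w : V, (G.deleteEdges EP).Reachable v w → lam v = lam w) ∧
    ∀ g : Fin b, {v | lam v = g}.ncard = sizes g

/-- `C` is a `P`-component: a connected component of `G − E_P`. -/
def IsPComp {V : Type} (G : SimpleGraph V) (EP : Set (Sym2 V)) (C : Set V) : Prop :=
  ∃ v : V, C = {w | (G.deleteEdges EP).Reachable v w}

end TP

open TP

namespace TPaux
open TP

lemma valid_card (t : RBT) : {l | t.Valid l}.Finite ∧ {l | t.Valid l}.ncard ≤ t.size := by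
  induction t with
  | nil => simp [RBT.Valid, RBT.size]
  | node l r hl hr =>
    have hsub : {x | (RBT.node l r).Valid x} ⊆
        insert [] ((List.cons false) '' {x | l.Valid x} ∪ (List.cons true) '' {x | r.Valid x}) := by
      intro x hx
      match x, hx with
      | [], _ => simp
      | false :: bs, hx => right; left; exact ⟨bs, hx, rfl⟩
      | true :: bs, hx => right; right; exact ⟨bs, hx, rfl⟩
    have hfin : (insert [] ((List.cons false) '' {x | l.Valid x} ∪
        (List.cons true) '' {x | r.Valid x})).Finite :=
      ((hl.1.image _).union (hr.1.image _)).insert _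
    refine ⟨hfin.subset hsub, ?_⟩
    have h1 := Set.ncard_le_ncard hsub hfin
    have h2 := Set.ncard_insert_le [] ((List.cons false) '' {x | l.Valid x} ∪
        (List.cons true) '' {x | r.Valid x})
    have h3 := Set.ncard_union_le ((List.cons false) '' {x | l.Valid x})
        ((List.cons true) '' {x | r.Valid x})
    have h4 := Set.ncard_image_le (f := List.cons false) hl.1
    have h5 := Set.ncard_image_le (f := List.cons true) hr.1
    simp only [RBT.size]
    omega

/-- the subtree of `T_i` at position `t`. -/
def Sub {k : ℕ} {Tsh : Fin (3*k) → RBT} (i : Fin (3*k)) (t : List Bool) : Set (Vtx k Tsh) :=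
  {v | ∃ x : {l : List Bool // (Tsh i).Valid l}, t <+: x.1 ∧ v = Sum.inr ⟨i, x⟩}

lemma sub_card {k : ℕ} {Tsh : Fin (3*k) → RBT} (i : Fin (3*k)) (t : List Bool) (r : RBT)
    (h : ∀ y, (Tsh i).Valid (t ++ y) → r.Valid y) :
    (Sub i t : Set (Vtx k Tsh)).ncard ≤ r.size := by
  obtain ⟨hf, hc⟩ := valid_card r
  let f : Vtx k Tsh → List Bool := fun v => match v with
    | Sum.inl _ => []
    | Sum.inr x => x.2.1
  have hinj : Set.InjOn f (Sub i t) := by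
    rintro _ ⟨x, hx, rfl⟩ _ ⟨y, hy, rfl⟩ hxy
    have : x = y := Subtype.ext hxy
    rw [this]
  rw [← hinj.ncard_image]
  have hsub : f '' (Sub i t) ⊆ (fun y => t ++ y) '' {y | r.Valid y} := by
    rintro _ ⟨_, ⟨⟨x, hv⟩, ⟨y, hy⟩, rfl⟩, rfl⟩
    dsimp only at hy
    subst hy
    exact ⟨y, h y hv, rfl⟩
  have h1 := Set.ncard_le_ncard hsub (hf.image _)
  have h2 := Set.ncard_image_le (f := fun y => t ++ y) hf
  omega

lemma sep {V : Type} (G : SimpleGraph V) (EP : Set (Sym2 V)) (S : Set V) (x : V)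
    (h : ∀ u v, G.Adj u v → u ∈ S → v ∉ S → u = x) (u w : V)
    (hr : (G.deleteEdges EP).Reachable u w) (hu : u ∈ S) (hw : w ∉ S) :
    (G.deleteEdges EP).Reachable u x := by
  obtain ⟨p⟩ := hr
  induction p with
  | nil => exact absurd hu hw
  | @cons a b c hab p ih =>
    by_cases hb : b ∈ S
    · exact hab.reachable.trans (ih hb hw)
    · rw [h a b ((SimpleGraph.deleteEdges_adj.1 hab).1) hu hb]

lemma cross {k : ℕ} {Tsh : Fin (3*k) → RBT} (i : Fin (3*k)) (t : List Bool)
    (u v : Vtx k Tsh) (h : (TGraph k Tsh).Adj u v) (hu : u ∈ (Sub i t : Set (Vtx k Tsh)))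
    (hv : v ∉ (Sub i t : Set (Vtx k Tsh))) :
    (∀ ht, u = Sum.inr ⟨i, ⟨t, ht⟩⟩) ∧ (t = [] → v = Sum.inl i) ∧
      (∀ p c hp, t = p ++ [c] → v = Sum.inr ⟨i, ⟨p, hp⟩⟩) := by
  obtain ⟨⟨x, hx⟩, hpre, rfl⟩ := hu
  dsimp only at hpre
  rw [TGraph, SimpleGraph.fromRel_adj] at h
  obtain ⟨-, h⟩ := h
  rcases v with j | ⟨j, ⟨y, hy⟩⟩
  · simp only [false_or] at h
    obtain ⟨rfl, rfl⟩ := h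
    have : t = [] := by simpa using hpre
    subst this
    simp
  · rcases h with h | h
    · obtain ⟨rfl, c, h⟩ := h
      dsimp only at h
      exact absurd ⟨⟨y, hy⟩, by dsimp only; rw [h]; exact hpre.trans (List.prefix_append _ _), rfl⟩ hv
    · obtain ⟨rfl, c, h⟩ := h
      dsimp only at h
      have hny : ¬ t <+: y := fun hh => hv ⟨⟨y, hy⟩, hh, rfl⟩
      have : t = x := by
        rw [h, List.prefix_concat_iff] at hpre
        rcases hpre with hh | hh
        · rw [h, hh]
        · exact absurd hh hny
      subst this
      refine ⟨fun _ => rfl, fun h0 => ?_, fun p c' hp h' => ?_⟩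
      · exact absurd (h0 ▸ List.nil_prefix) hny
      · rw [h] at h'
        obtain ⟨rfl, -⟩ := List.append_inj' h' rfl
        rfl

end TPaux

/-- Lemma 1 of the paper: for a solution `P` of `(T, 6k−1, 4k)`, `m ∈ ℕ`, and a partial-`T`
(obtained by removing from `T` a collection `C'` of `P`-components each contained in some `T_i`),
the partial-`T` cannot simultaneously satisfy:
(1) the set `𝒯` of indices of partial-`T_i`'s of size at least `s − 1 + a_i − 6k` whose
partial-`R_i` is not a `P`-component has cardinality `m`;
(2) the partial-`T` contains exactly `2m` `P`-components;
(3) the partial-`T` contains a partial-`T_{i₀}` with `i₀ ∉ 𝒯` of size at least `a_{i₀} + 1 − 6k`. -/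
theorem statement0
    (k s : ℕ) (hk : 1 ≤ k) (hs4 : 4 ∣ s) (hs : 24 * k < s)
    (a : Fin (3*k) → ℕ) (ha : ∀ i, s / 4 + 6 * k ≤ a i ∧ a i ≤ s / 2 - 18 * k)
    (Lsh Rsh : Fin (3*k) → RBT)
    (hL : ∀ i, (Lsh i).IsNice ∧ (Lsh i).size = a i)
    (hR : ∀ i, (Rsh i).IsNice ∧ (Rsh i).size = s - 2)
    (EP : Set (Sym2 (Vtx k (nodes Lsh Rsh)))) (lam : Vtx k (nodes Lsh Rsh) → Fin (4*k))
    (hP : IsSolutionEq (TGraph k (nodes Lsh Rsh)) EP (6*k - 1) (4*k) (fun _ => s) lam)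
    (m : ℕ) (C' : Set (Set (Vtx k (nodes Lsh Rsh))))
    (hC' : ∀ C ∈ C', IsPComp (TGraph k (nodes Lsh Rsh)) EP C ∧
      ∃ i : Fin (3*k), C ⊆ TiSet k (nodes Lsh Rsh) i) :
    ¬ (({i : Fin (3*k) |
          s - 1 + a i - 6*k ≤ (TiSet k (nodes Lsh Rsh) i ∩ (Set.univ \ ⋃₀ C')).ncard ∧
          ¬ IsPComp (TGraph k (nodes Lsh Rsh)) EP
              (RiSet k (nodes Lsh Rsh) i ∩ (Set.univ \ ⋃₀ C'))}.ncard = m) ∧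
       ({C : Set (Vtx k (nodes Lsh Rsh)) |
          IsPComp (TGraph k (nodes Lsh Rsh)) EP C ∧ C ⊆ Set.univ \ ⋃₀ C'}.ncard = 2*m) ∧
       (∃ i0 : Fin (3*k),
          i0 ∉ {i : Fin (3*k) |
            s - 1 + a i - 6*k ≤ (TiSet k (nodes Lsh Rsh) i ∩ (Set.univ \ ⋃₀ C')).ncard ∧
            ¬ IsPComp (TGraph k (nodes Lsh Rsh)) EP
                (RiSet k (nodes Lsh Rsh) i ∩ (Set.univ \ ⋃₀ C'))} ∧
          a i0 + 1 - 6*k ≤ (TiSet k (nodes Lsh Rsh) i0 ∩ (Set.univ \ ⋃₀ C')).ncard)) := by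
  classical
  rintro ⟨h1, h2, i0, hi0, hi0s⟩
  obtain ⟨-, -, hlam, hsz⟩ := hP
  replace hsz : ∀ g : Fin (4*k), {v | lam v = g}.ncard = s := hsz
  set G := TGraph k (nodes Lsh Rsh) with hG
  set W : Set (Vtx k (nodes Lsh Rsh)) := Set.univ \ ⋃₀ C' with hW
  set Tau := {i : Fin (3*k) |
          s - 1 + a i - 6*k ≤ (TiSet k (nodes Lsh Rsh) i ∩ W).ncard ∧
          ¬ IsPComp G EP (RiSet k (nodes Lsh Rsh) i ∩ W)} with hTau
  have hfinV : (Set.univ : Set (Vtx k (nodes Lsh Rsh))).Finite := by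
    have : (Set.univ : Set (Vtx k (nodes Lsh Rsh))) = ⋃ g : Fin (4*k), {v | lam v = g} := by
      ext v; simp
    rw [this]
    refine Set.finite_iUnion fun g => Set.finite_of_ncard_pos ?_
    rw [hsz g]; omega
  have : Finite (Vtx k (nodes Lsh Rsh)) := Set.finite_univ_iff.1 hfinV
  let comp : Vtx k (nodes Lsh Rsh) → Set (Vtx k (nodes Lsh Rsh)) :=
    fun v => {w | (G.deleteEdges EP).Reachable v w}
  have hcomp_le : ∀ v, (comp v).ncard ≤ s := by
    intro v
    rw [← hsz (lam v)]
    refine Set.ncard_le_ncard ?_ (Set.toFinite _)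
    intro w hw
    exact (hlam v w hw).symm
  have hcomp_eq : ∀ C, IsPComp G EP C → ∀ v ∈ C, C = comp v := by
    rintro C ⟨u, rfl⟩ v hv
    ext w
    exact ⟨fun h => (SimpleGraph.Reachable.symm hv).trans h, fun h => SimpleGraph.Reachable.trans hv h⟩
  have hcomp_mem : ∀ v, v ∈ comp v := fun v => SimpleGraph.Reachable.refl v
  have hpC : ∀ v, IsPComp G EP (comp v) := fun v => ⟨v, rfl⟩
  have hcompW : ∀ v, v ∈ W → comp v ⊆ W := by
    intro v hv w hw
    refine ⟨trivial, ?_⟩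
    rintro ⟨C, hC, hwC⟩
    refine hv.2 ⟨C, hC, ?_⟩
    rw [hcomp_eq C (hC' C hC).1 w hwC]
    exact SimpleGraph.Reachable.symm hw
  have hTi : ∀ i, TiSet k (nodes Lsh Rsh) i = TPaux.Sub i [] := by
    intro i; ext v; simp [TiSet, TPaux.Sub]
  have hRi : ∀ i, RiSet k (nodes Lsh Rsh) i = TPaux.Sub i [true] := by
    intro i; ext v
    constructor
    · rintro ⟨⟨x, hx⟩, h, rfl⟩
      refine ⟨⟨x, hx⟩, ?_, rfl⟩
      dsimp only at h ⊢
      cases x with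
      | nil => simp at h
      | cons b x => simp at h; subst h; simp
    · rintro ⟨⟨x, hx⟩, h, rfl⟩
      refine ⟨⟨x, hx⟩, ?_, rfl⟩
      dsimp only at h ⊢
      cases x with
      | nil => simp at h
      | cons b x => simp at h; subst h; simp
  have hinlW : ∀ i, (Sum.inl i : Vtx k (nodes Lsh Rsh)) ∈ W := by
    intro i
    refine ⟨trivial, ?_⟩
    rintro ⟨C, hC, hwC⟩
    obtain ⟨j, hj⟩ := (hC' C hC).2
    obtain ⟨x, hx⟩ := hj hwC
    simp at hx
  have hroot : ∀ i, (nodes Lsh Rsh i).Valid [] := fun i => trivial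
  -- separation at `T_i`
  have hsepT : ∀ i v, v ∈ (TPaux.Sub i [] : Set (Vtx k (nodes Lsh Rsh))) →
      comp v ⊆ TPaux.Sub i [] ∨ v ∈ comp (Sum.inl i) := by
    intro i v hv
    by_cases h : comp v ⊆ TPaux.Sub i []
    · exact Or.inl h
    · right
      obtain ⟨w, hw, hwn⟩ := Set.not_subset.1 h
      have := TPaux.sep G EP (TPaux.Sub i [])ᶜ (Sum.inl i) (by
        intro u v huv hu hv
        rw [Set.notMem_compl_iff] at hv
        exact (TPaux.cross i [] v u huv.symm hv hu).2.1 rfl) w v (SimpleGraph.Reachable.symm hw) hwn (by simpa using hv)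
      exact (SimpleGraph.Reachable.trans hw this).symm
  have hsepIn : ∀ i t, ∀ v w, v ∈ (TPaux.Sub i t : Set (Vtx k (nodes Lsh Rsh))) → w ∉ (TPaux.Sub i t : Set (Vtx k (nodes Lsh Rsh))) →
      w ∈ comp v → ∀ ht, Sum.inr ⟨i, ⟨t, ht⟩⟩ ∈ comp v := by
    intro i t v w hv hw hvw ht
    exact TPaux.sep G EP (TPaux.Sub i t) _ (fun u v huv hu hv =>
      (TPaux.cross i t u v huv hu hv).1 ht) v w hvw hv hw
  have hsepOut : ∀ i p c, ∀ v w, v ∈ (TPaux.Sub i (p ++ [c]) : Set (Vtx k (nodes Lsh Rsh))) →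
      w ∉ (TPaux.Sub i (p ++ [c]) : Set (Vtx k (nodes Lsh Rsh))) →
      w ∈ comp v → ∀ hp, Sum.inr ⟨i, ⟨p, hp⟩⟩ ∈ comp v := by
    intro i p c v w hv hw hvw hp
    have := TPaux.sep G EP (TPaux.Sub i (p ++ [c]))ᶜ (Sum.inr ⟨i, ⟨p, hp⟩⟩) (by
        intro u v huv hu hv
        rw [Set.notMem_compl_iff] at hv
        exact (TPaux.cross i _ v u huv.symm hv hu).2.2 p c hp rfl) w v (SimpleGraph.Reachable.symm hvw) hw (by simpa using hv)
    exact SimpleGraph.Reachable.trans hvw this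
  let In : Fin (3*k) → Set (Set (Vtx k (nodes Lsh Rsh))) := fun i =>
    {C | IsPComp G EP C ∧ C ⊆ W ∧ C ⊆ TPaux.Sub i []}
  let D : Fin (3*k) → Set (Vtx k (nodes Lsh Rsh)) := fun i => comp (Sum.inl i) ∩ TPaux.Sub i []
  have hcover : ∀ i v, v ∈ TPaux.Sub i [] ∩ W → comp v ∈ In i ∨ v ∈ D i := by
    intro i v hv
    rcases hsepT i v hv.1 with h | h
    · exact Or.inl ⟨hpC v, hcompW v hv.2, h⟩
    · exact Or.inr ⟨h, hv.1⟩
  have hD_le : ∀ i, (D i).ncard ≤ s := fun i =>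
    (Set.ncard_le_ncard Set.inter_subset_left (Set.toFinite _)).trans (hcomp_le (Sum.inl i))
  have hzero : ∀ i, (In i).ncard = 0 → (TPaux.Sub i [] ∩ W).ncard ≤ (D i).ncard := by
    intro i hi
    rw [Set.ncard_eq_zero (Set.toFinite _)] at hi
    refine Set.ncard_le_ncard ?_ (Set.toFinite _)
    intro v hv
    rcases hcover i v hv with h | h
    · rw [hi] at h; exact absurd h (Set.notMem_empty _)
    · exact h
  have hbig : ∀ i ∈ Tau, (In i).ncard = 0 ∨ (In i).ncard = 1 →
      3 * s ≤ 4 * (D i).ncard := by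
    rintro i ⟨hi1, hi2⟩ hor
    rw [hTi] at hi1
    rw [hRi] at hi2
    have hai := ha i
    rcases hor with hor | hor
    · have := hzero i hor
      have := hD_le i
      omega
    · obtain ⟨C, hC⟩ := Set.ncard_eq_one.1 hor
      have hCin : C ∈ In i := by rw [hC]; rfl
      obtain ⟨hCp, hCW, hCT⟩ := hCin
      have hCc := hcomp_eq C hCp
      have hsub : TPaux.Sub i [] ∩ W ⊆ C ∪ D i := by
        intro v hv
        rcases hcover i v hv with h | h
        · rw [hC] at h
          left
          rw [← (show comp v = C from h)]
          exact hcomp_mem v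
        · exact Or.inr h
      have hcard : (TPaux.Sub i [] ∩ W : Set (Vtx k (nodes Lsh Rsh))).ncard ≤ C.ncard + (D i).ncard :=
        (Set.ncard_le_ncard hsub (Set.toFinite _)).trans (Set.ncard_union_le _ _)
      have hCs : C.ncard ≤ s := by
        obtain ⟨v, hv⟩ := hCp
        rw [hv]; exact hcomp_le v
      -- `D i` is nonempty
      have hDne : (D i).Nonempty := by
        rw [Set.nonempty_iff_ne_empty]
        intro h
        rw [h, Set.ncard_empty] at hcard
        omega
      have hrootD : (Sum.inr ⟨i, ⟨[], hroot i⟩⟩ : Vtx k (nodes Lsh Rsh)) ∈ comp (Sum.inl i) := by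
        obtain ⟨v, hv1, hv2⟩ := hDne
        have := hsepIn i [] v (Sum.inl i) hv2 (by rintro ⟨x, -, hx⟩; simp at hx)
          (SimpleGraph.Reachable.symm hv1) (hroot i)
        exact SimpleGraph.Reachable.trans hv1 this
      have hinlC : (Sum.inl i : Vtx k (nodes Lsh Rsh)) ∉ C := by
        intro h
        obtain ⟨x, -, hx⟩ := hCT h
        simp at hx
      have hrootC : ∀ h, (Sum.inr ⟨i, ⟨[], h⟩⟩ : Vtx k (nodes Lsh Rsh)) ∉ C := by
        intro h' h
        apply hinlC
        rw [hCc _ h]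
        exact SimpleGraph.Reachable.symm hrootD
      -- containment
      have hcont : ∀ p c, (∀ hp, (Sum.inr ⟨i, ⟨p, hp⟩⟩ : Vtx k (nodes Lsh Rsh)) ∉ C) →
          (nodes Lsh Rsh i).Valid p →
          ∀ v ∈ C, v ∈ (TPaux.Sub i (p ++ [c]) : Set (Vtx k (nodes Lsh Rsh))) →
          C ⊆ TPaux.Sub i (p ++ [c]) := by
        intro p c hp hpv v hv hvS w hw
        by_contra hwS
        rw [hCc v hv] at hw
        have := hsepOut i p c v w hvS hwS hw hpv
        rw [← hCc v hv] at this
        exact hp _ this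
      obtain ⟨v, hv⟩ : C.Nonempty := by
        obtain ⟨v, rfl⟩ := hCp
        exact ⟨v, hcomp_mem v⟩
      obtain ⟨⟨x, hx⟩, -, hvx⟩ := hCT hv
      match x, hx, hvx with
      | [], hx, hvx => exact absurd (hvx ▸ hv) (hrootC hx)
      | false :: y, hx, hvx =>
        have hCL := hcont [] false hrootC (hroot i) v hv ⟨⟨_, hx⟩, by simp, hvx⟩
        have h3 := Set.ncard_le_ncard hCL (Set.toFinite _)
        have h4 := TPaux.sub_card (k := k) (Tsh := nodes Lsh Rsh) i ([] ++ [false]) (Lsh i) (fun y hy => by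
          simpa [nodes, RBT.Valid] using hy)
        rw [(hL i).2] at h4
        omega
      | true :: y, hx, hvx =>
        have hCR := hcont [] true hrootC (hroot i) v hv ⟨⟨_, hx⟩, by simp, hvx⟩
        rw [List.nil_append] at hCR
        have hRne : ∃ l r, Rsh i = RBT.node l r := by
          cases hh : Rsh i with
          | nil => 
            have := (hR i).2
            rw [hh, RBT.size] at this
            omega
          | node l r => exact ⟨l, r, rfl⟩
        obtain ⟨l, r, hlr⟩ := hRne
        have hvt : (nodes Lsh Rsh i).Valid [true] := by
          change (Rsh i).Valid []
          rw [hlr]; trivial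
        have htC : ∀ h, (Sum.inr ⟨i, ⟨[true], h⟩⟩ : Vtx k (nodes Lsh Rsh)) ∉ C := by
          intro h htC
          apply hi2
          have : TPaux.Sub i [true] ∩ W = C := by
            apply Set.Subset.antisymm
            · rintro u ⟨hu1, hu2⟩
              have hu0 : u ∈ (TPaux.Sub i [] : Set (Vtx k (nodes Lsh Rsh))) := by
                obtain ⟨x, -, hx⟩ := hu1
                exact ⟨x, by simp, hx⟩
              rcases hsub ⟨hu0, hu2⟩ with hh | hh
              · exact hh
              · have := hsepIn i [true] u (Sum.inl i) hu1 (by rintro ⟨x, -, hx⟩; simp at hx)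
                  (SimpleGraph.Reachable.symm hh.1) h
                rw [hCc _ htC]
                exact SimpleGraph.Reachable.symm this
            · exact fun u hu => ⟨hCR hu, hCW hu⟩
          rw [this]; exact hCp
        have hRs := (hR i).2
        have hRn := (hR i).1
        rw [hlr] at hRs hRn
        obtain ⟨-, -, hd⟩ := hRn
        rw [RBT.size] at hRs
        rw [Nat.dist] at hd
        match y, hx, hvx with
        | [], hx, hvx => exact absurd (hvx ▸ hv) (htC hx)
        | c :: z, hx, hvx =>
          have hCc' := hcont [true] c htC hvt v hv ⟨⟨_, hx⟩, by simp, hvx⟩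
          have h3 := Set.ncard_le_ncard hCc' (Set.toFinite _)
          have h4 : (TPaux.Sub i ([true] ++ [c]) : Set (Vtx k (nodes Lsh Rsh))).ncard ≤ s / 2 - 1 := by
            cases c with
            | false =>
              refine (TPaux.sub_card (k := k) (Tsh := nodes Lsh Rsh) i ([true] ++ [false]) l (fun y hy => ?_)).trans (by omega)
              change (Rsh i).Valid (false :: y) at hy
              rw [hlr] at hy
              exact hy
            | true =>
              refine (TPaux.sub_card (k := k) (Tsh := nodes Lsh Rsh) i ([true] ++ [true]) r (fun y hy => ?_)).trans (by omega)
              change (Rsh i).Valid (true :: y) at hy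
              rw [hlr] at hy
              exact hy
          omega
  -- counting
  let U : Finset (Fin (3*k)) := insert i0 Tau.toFinset
  let w : Fin (3*k) → ℕ := fun i => if i ∈ Tau then 2 else 1
  let B : Finset (Fin (3*k)) := U.filter (fun i => (In i).ncard < w i)
  have hi0U : (TPaux.Sub i0 [] ∩ W : Set (Vtx k (nodes Lsh Rsh))).ncard = (TiSet k (nodes Lsh Rsh) i0 ∩ W).ncard := by
    rw [hTi]
  have hsumw : ∑ i ∈ U, w i = 2 * m + 1 := by
    have hnot : i0 ∉ Tau.toFinset := by simpa using hi0
    rw [Finset.sum_insert hnot]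
    have e1 : w i0 = 1 := if_neg hi0
    have e2 : ∑ i ∈ Tau.toFinset, w i = ∑ i ∈ Tau.toFinset, 2 :=
      Finset.sum_congr rfl fun i hi => if_pos (by simpa using hi)
    rw [e1, e2, Finset.sum_const, ← Set.ncard_eq_toFinset_card', h1]
    simp; ring
  have hBprop : ∀ i ∈ B, i ∈ Tau ∧ 3 * s ≤ 4 * (D i).ncard ∨ i = i0 ∧ s < 4 * (D i).ncard := by
    intro i hi
    obtain ⟨hiU, hlt⟩ := Finset.mem_filter.1 hi
    by_cases hT : i ∈ Tau
    · left
      have : w i = 2 := if_pos hT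
      exact ⟨hT, hbig i hT (by omega)⟩
    · right
      have hii : i = i0 := by
        rcases Finset.mem_insert.1 hiU with h | h
        · exact h
        · exact absurd (by simpa using h) hT
      have : w i = 1 := if_neg hT
      have hz := hzero i (by omega)
      subst hii
      have := ha i
      exact ⟨rfl, by omega⟩
  have hBinj : Set.InjOn (fun i => comp (Sum.inl i)) (B : Set (Fin (3*k))) := by
    intro i hi j hj hij
    by_contra hne
    have hdisj : Disjoint (D i) (D j) := by
      rw [Set.disjoint_left]
      rintro v ⟨-, ⟨x, -, hx⟩⟩ ⟨-, ⟨y, -, hy⟩⟩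
      rw [hx] at hy
      apply hne
      have := Sum.inr.inj hy
      exact congrArg Sigma.fst this
    have hsubs : insert (Sum.inl i) (D i ∪ D j) ⊆ comp (Sum.inl i) := by
      apply Set.insert_subset (hcomp_mem _)
      apply Set.union_subset Set.inter_subset_left
      have hij' : comp (Sum.inl i) = comp (Sum.inl j) := hij
      rw [hij']
      exact Set.inter_subset_left
    have hnm : (Sum.inl i : Vtx k (nodes Lsh Rsh)) ∉ D i ∪ D j := by
      rintro (⟨-, ⟨x, -, hx⟩⟩ | ⟨-, ⟨x, -, hx⟩⟩) <;> simp at hx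
    have e1 := Set.ncard_le_ncard hsubs (Set.toFinite _)
    rw [Set.ncard_insert_of_notMem hnm (Set.toFinite _), Set.ncard_union_eq hdisj (Set.toFinite _) (Set.toFinite _)] at e1
    have e2 := hcomp_le (Sum.inl i)
    rcases hBprop i hi with ⟨-, h3⟩ | ⟨h3, h3'⟩ <;> rcases hBprop j hj with ⟨-, h4⟩ | ⟨h4, h4'⟩
    · omega
    · omega
    · omega
    · exact hne (h3.trans h4.symm)
  let PC : Finset (Set (Vtx k (nodes Lsh Rsh))) := B.image (fun i => comp (Sum.inl i))
  have hPC : PC.card = B.card := Finset.card_image_of_injOn hBinj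
  let IF : Fin (3*k) → Finset (Set (Vtx k (nodes Lsh Rsh))) := fun i => (Set.toFinite (In i)).toFinset
  have hIF : ∀ i, (IF i).card = (In i).ncard := fun i => (Set.ncard_eq_toFinset_card _ _).symm
  have hbU : (U.biUnion IF).card = ∑ i ∈ U, (In i).ncard := by
    rw [Finset.card_biUnion]
    · exact Finset.sum_congr rfl fun i _ => hIF i
    · intro i _ j _ hne
      change Disjoint (IF i) (IF j)
      rw [Finset.disjoint_left]
      intro C hCi hCj
      have hCi' : C ∈ In i := by simpa [IF] using hCi
      have hCj' : C ∈ In j := by simpa [IF] using hCj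
      obtain ⟨v, hv⟩ := hCi'.1
      have hvC : v ∈ C := by rw [hv]; exact hcomp_mem v
      obtain ⟨x, -, hx⟩ := hCi'.2.2 hvC
      obtain ⟨y, -, hy⟩ := hCj'.2.2 hvC
      rw [hx] at hy
      exact hne (congrArg Sigma.fst (Sum.inr.inj hy))
  have hdisj : Disjoint PC (U.biUnion IF) := by
    rw [Finset.disjoint_left]
    intro C hC1 hC2
    obtain ⟨j, -, rfl⟩ := Finset.mem_image.1 hC1
    obtain ⟨i, -, hi⟩ := Finset.mem_biUnion.1 hC2
    have hi' : comp (Sum.inl j) ∈ In i := by simpa [IF] using hi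
    obtain ⟨x, -, hx⟩ := hi'.2.2 (hcomp_mem _)
    simp at hx
  have htot : (PC ∪ U.biUnion IF).card ≤ 2 * m := by
    rw [← h2, ← Set.ncard_coe_finset]
    refine Set.ncard_le_ncard ?_ (Set.toFinite _)
    intro C hC
    rcases Finset.mem_union.1 (Finset.mem_coe.1 hC) with h | h
    · obtain ⟨j, -, rfl⟩ := Finset.mem_image.1 h
      exact ⟨hpC _, hcompW _ (hinlW j)⟩
    · obtain ⟨i, -, hi⟩ := Finset.mem_biUnion.1 h
      have hi' : C ∈ In i := by simpa [IF] using hi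
      exact ⟨hi'.1, hi'.2.1⟩
  rw [Finset.card_union_of_disjoint hdisj, hbU, hPC] at htot
  have hle : ∑ i ∈ U, w i ≤ ∑ i ∈ U, ((In i).ncard + if (In i).ncard < w i then 1 else 0) := by
    refine Finset.sum_le_sum fun i hi => ?_
    by_cases hT : i ∈ Tau
    · have hw2 : w i = 2 := if_pos hT
      have : (In i).ncard ≠ 0 := by
        intro h0
        have := hzero i h0
        have := hD_le i
        have h5 := hT.1
        rw [hTi] at h5
        have := ha i
        omega
      split_ifs <;> omega
    · have hw1 : w i = 1 := if_neg hT
      split_ifs <;> omega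
  rw [Finset.sum_add_distrib, hsumw, ← Finset.card_filter] at hle
  change _ ≤ _ + B.card at hle
  omega
end

section
/- For every solution P = (E_P, λ_P) of the instance (T, 6k−1, 4k) and every i ∈ {1,...,3k}, the subtree R_i is not a P-component. -/
open TP

namespace TP

/-- Value of a component of size `x`. -/
def vv (M s x : ℕ) : ℕ :=
  if x < M then x else if s < x + M ∧ x < s then 2 * M + x - s else M

lemma vv_ge_M {M s x : ℕ} (h : M ≤ x) : M ≤ vv M s x := by
  unfold vv; split_ifs <;> omega

lemma vv_small {M s x : ℕ} (h : x < M) : vv M s x = x := by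
  unfold vv; rw [if_pos h]

lemma vv_pos {M s x : ℕ} (hM : 1 ≤ M) (h : 1 ≤ x) : 1 ≤ vv M s x := by
  unfold vv; split_ifs <;> omega

lemma vv_near {M s x y : ℕ} (h : M ≤ x) (hx : x < s) (hy : s ≤ x + y) :
    2 * M ≤ vv M s x + y := by
  unfold vv; split_ifs <;> omega

lemma vv_le {M s x : ℕ} (h : ¬ (s < x + M ∧ x < s)) : vv M s x ≤ M := by
  unfold vv; split_ifs <;> omega

lemma vv_sum_min {C : Type} (F : Finset C) (z : C → ℕ) (M s : ℕ)
    (h : M ≤ ∑ c ∈ F, z c) : M ≤ ∑ c ∈ F, vv M s (z c) := by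
  by_cases h1 : ∃ c ∈ F, M ≤ z c
  · obtain ⟨c, hc, hz⟩ := h1
    have := Finset.single_le_sum (f := fun c => vv M s (z c)) (fun _ _ => Nat.zero_le _) hc
    have := vv_ge_M (s := s) hz
    omega
  · push Not at h1
    rw [Finset.sum_congr rfl (fun c hc => vv_small (s := s) (h1 c hc))]
    exact h

lemma vv_sum_small {C : Type} (F : Finset C) (z : C → ℕ) (M s : ℕ)
    (h : ∑ c ∈ F, z c < M) : ∑ c ∈ F, vv M s (z c) = ∑ c ∈ F, z c := by
  apply Finset.sum_congr rfl
  intro c hc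
  apply vv_small
  have := Finset.single_le_sum (f := z) (fun _ _ => Nat.zero_le _) hc
  omega

lemma group_lemma {C : Type} [DecidableEq C] (F : Finset C) (z : C → ℕ) (M s : ℕ)
    (hsum : ∑ c ∈ F, z c = s) (hM : 2 * M ≤ s) :
    ∑ c ∈ F, vv M s (z c) ≤ M * F.card := by
  by_cases h : ∃ c ∈ F, s < z c + M ∧ z c < s
  · obtain ⟨c0, hc0, h1, h2⟩ := h
    have e1 := Finset.add_sum_erase F z hc0
    have e2 := Finset.add_sum_erase F (fun c => vv M s (z c)) hc0
    have hne : (F.erase c0).Nonempty := by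
      by_contra hn
      rw [Finset.not_nonempty_iff_eq_empty] at hn
      rw [hn] at e1
      simp at e1
      omega
    obtain ⟨c1, hc1⟩ := hne
    have hle : ∀ c ∈ F.erase c0, z c < M ∧ z c + z c0 ≤ s := by
      intro c hc
      have := Finset.single_le_sum (f := z) (fun _ _ => Nat.zero_le _) hc
      omega
    have e3 := Finset.add_sum_erase (F.erase c0) (fun c => vv M s (z c)) hc1
    have e4 : ∑ c ∈ (F.erase c0).erase c1, vv M s (z c) ≤ ((F.erase c0).erase c1).card • M := by
      apply Finset.sum_le_card_nsmul
      intro c hc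
      have := hle c (Finset.mem_of_mem_erase hc)
      rw [vv_small this.1]
      exact this.1.le
    have c1' := Finset.card_erase_add_one hc0
    have c2' := Finset.card_erase_add_one hc1
    have h3 := hle c1 hc1
    have v1 : vv M s (z c1) = z c1 := vv_small h3.1
    have v0 : vv M s (z c0) = 2 * M + z c0 - s := by
      unfold vv; rw [if_neg (by omega), if_pos ⟨h1, h2⟩]
    rw [← c1', ← c2']
    simp only [smul_eq_mul] at *
    rw [Nat.mul_add, Nat.mul_add, Nat.mul_comm M]
    omega
  · push Not at h
    have := Finset.sum_le_card_nsmul F (fun c => vv M s (z c)) M (by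
      intro c hc
      apply vv_le
      intro h'
      have := h c hc h'.1
      omega)
    rw [smul_eq_mul, Nat.mul_comm] at this
    exact this

lemma top_lemma {ι : Type} [DecidableEq ι] (I : Finset ι) (t B a : ι → ℕ) (k s M x : ℕ)
    (hM : M = 6 * k + 1) (hk : 1 ≤ k) (hs : 96 * k ≤ s) (hs4 : 4 ∣ s)
    (ha : ∀ i, s / 4 + 6 * k ≤ a i) (hx : ∑ i ∈ I, t i ≤ x) (hxs : x ≤ s) (hx1 : 1 ≤ x)
    (hI : I.card ≤ 3 * k)
    (hc : ∀ i ∈ I, 2 * M ≤ B i ∨ (2 * M ≤ B i + 2 ∧ a i + 3 ≤ t i + M) ∨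
      (M ≤ B i ∧ s / 2 + a i + 2 ≤ t i + M)) :
    2 * M * I.card ≤ vv M s x + ∑ i ∈ I, B i ∧
    ∀ i0 ∈ I, (3 * M ≤ B i0 + 2 ∨ (2 * M ≤ B i0 + 2 ∧ a i0 + 3 ≤ t i0 + M)) →
      2 * M * I.card < vv M s x + ∑ i ∈ I, B i := by
  have hone : ∀ i ∈ I, t i ≤ x := fun i hi =>
    (Finset.single_le_sum (f := t) (fun _ _ => Nat.zero_le _) hi).trans hx
  have hcomm : 2 * M * I.card = I.card * (2 * M) := Nat.mul_comm _ _
  by_cases h : ∃ j ∈ I, ¬ (2 * M ≤ B j + 2)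
  · obtain ⟨j, hj, hjB⟩ := h
    have hjP : M ≤ B j ∧ s / 2 + a j + 2 ≤ t j + M := by
      rcases hc j hj with h | h | h
      · omega
      · omega
      · exact h
    have haj := ha j
    have hvx : M ≤ vv M s x := vv_ge_M (by have := hone j hj; omega)
    have hpair : ∀ i ∈ I.erase j, t i + t j ≤ s := by
      intro i hi
      have := Finset.single_le_sum (f := t) (fun _ _ => Nat.zero_le _) hi
      have := Finset.add_sum_erase I t hj
      omega
    have hR : ∀ i ∈ I.erase j, ¬ (a i + 3 ≤ t i + M) := by
      intro i hi
      have := hpair i hi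
      have := ha i
      omega
    have hG : ∀ i ∈ I.erase j, 2 * M ≤ B i := by
      intro i hi
      have := hR i hi
      rcases hc i (Finset.mem_of_mem_erase hi) with h | h | h <;> omega
    have e1 := Finset.add_sum_erase I B hj
    have c1 := Finset.card_erase_add_one hj
    have e2 := Finset.card_nsmul_le_sum (I.erase j) (fun i => B i) (2 * M) hG
    rw [smul_eq_mul] at e2
    rw [hcomm, ← c1, Nat.add_mul]
    refine ⟨by omega, ?_⟩
    intro i0 hi0 h0
    have hne : i0 ≠ j := by rintro rfl; omega
    have hi0' : i0 ∈ I.erase j := Finset.mem_erase.2 ⟨hne, hi0⟩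
    have h0' : 3 * M ≤ B i0 + 2 := by
      rcases h0 with h | h
      · exact h
      · exact absurd h.2 (hR i0 hi0')
    have e3 := Finset.add_sum_erase (I.erase j) B hi0'
    have c2 := Finset.card_erase_add_one hi0'
    have e4 := Finset.card_nsmul_le_sum ((I.erase j).erase i0) (fun i => B i) (2 * M)
      (fun i hi => hG i (Finset.mem_of_mem_erase hi))
    rw [smul_eq_mul] at e4
    rw [← c2, Nat.add_mul]
    omega
  · push Not at h
    have hst : 2 * M * I.card < vv M s x + ∑ i ∈ I, B i := by
      by_cases hall : ∀ i ∈ I, 2 * M ≤ B i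
      · have e2 := Finset.card_nsmul_le_sum I (fun i => B i) (2 * M) hall
        rw [smul_eq_mul] at e2
        have := vv_pos (M := M) (s := s) (by omega) hx1
        omega
      · push Not at hall
        obtain ⟨i, hi, hiB⟩ := hall
        have hai := ha i
        have hvx : M ≤ vv M s x := vv_ge_M (by
          have := hone i hi
          rcases hc i hi with h | h | h <;> omega)
        have e2 := Finset.card_nsmul_le_sum I (fun i => B i + 2) (2 * M) h
        rw [smul_eq_mul, Finset.sum_add_distrib, Finset.sum_const, smul_eq_mul] at e2
        omega
    exact ⟨hst.le, fun _ _ _ => hst⟩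

lemma block_lemma {C : Type} [DecidableEq C] (F : Finset C) (z : C → ℕ) (k s M a t : ℕ)
    (hM : M = 6 * k + 1) (hk : 1 ≤ k) (hs : 96 * k ≤ s) (hs4 : 4 ∣ s)
    (ha : s / 4 + 6 * k ≤ a) (ha' : a + 18 * k ≤ s / 2)
    (ht : s + a ≤ t + ∑ c ∈ F, z c) (hts : t ≤ s) (hz : ∀ c ∈ F, z c ≤ s)
    (hg : ∀ c ∈ F, s + a ≤ (∑ c ∈ F, z c) + 1 ∨ z c ≤ a ∨
      (z c ≤ s - 2 ∧ s - 2 ≤ ∑ c ∈ F, z c) ∨ 2 * z c + 2 ≤ s)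
    (ht' : t + ∑ c ∈ F, z c ≤ s + a) :
    2 * M ≤ ∑ c ∈ F, vv M s (z c) ∨
    (2 * M ≤ (∑ c ∈ F, vv M s (z c)) + 2 ∧ a + 3 ≤ t + M) ∨
      (M ≤ (∑ c ∈ F, vv M s (z c)) ∧ s / 2 + a + 2 ≤ t + M) := by
  by_cases h : ∃ c ∈ F, M ≤ z c
  · obtain ⟨c0, hc0, hz0⟩ := h
    have e1 := Finset.add_sum_erase F z hc0
    have e2 := Finset.add_sum_erase F (fun c => vv M s (z c)) hc0
    have v0 := vv_ge_M (s := s) hz0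
    by_cases hσ : M ≤ ∑ c ∈ F.erase c0, z c
    · have := vv_sum_min _ z M s hσ
      omega
    · have e3 := vv_sum_small (F.erase c0) z M s (by omega)
      have := hz c0 hc0
      rcases hg c0 hc0 with h | h | h | h
      · omega
      · omega
      · have := vv_near (M := M) (s := s) (y := s - z c0) hz0 (by omega) (by omega)
        omega
      · omega
  · push Not at h
    left
    have : ∑ c ∈ F, vv M s (z c) = ∑ c ∈ F, z c :=
      Finset.sum_congr rfl (fun c hc => vv_small (s := s) (h c hc))
    omega

lemma block_lemma_exact {C : Type} [DecidableEq C] (F : Finset C) (z : C → ℕ) (k s M a t : ℕ)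
    (hM : M = 6 * k + 1) (hk : 1 ≤ k) (hs : 96 * k ≤ s)
    (ht : s + a ≤ t + ∑ c ∈ F, z c) (c0 : C) (hc0 : c0 ∈ F) (hz0 : z c0 = s - 2) :
    3 * M ≤ (∑ c ∈ F, vv M s (z c)) + 2 ∨
    (2 * M ≤ (∑ c ∈ F, vv M s (z c)) + 2 ∧ a + 3 ≤ t + M) := by
  have e1 := Finset.add_sum_erase F z hc0
  have e2 := Finset.add_sum_erase F (fun c => vv M s (z c)) hc0
  have := vv_near (M := M) (s := s) (x := z c0) (y := 2) (by omega) (by omega) (by omega)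
  by_cases hσ : M ≤ ∑ c ∈ F.erase c0, z c
  · have := vv_sum_min _ z M s hσ
    omega
  · omega

end TP
namespace TP

lemma core {V C : Type} [Fintype V] [Fintype C] [DecidableEq C] [DecidableEq V]
    (comp : V → C) (hsurj : Function.Surjective comp) (k s M : ℕ)
    (hM : M = 6 * k + 1) (hk : 1 ≤ k) (hs : 96 * k ≤ s) (hs4 : 4 ∣ s)
    (hcard : Fintype.card C ≤ 6 * k) (lam : V → Fin (4 * k))
    (hlam : ∀ v w, comp v = comp w → lam v = lam w)
    (hgrp : ∀ g, (Finset.univ.filter (fun v => lam v = g)).card = s)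
    (a : Fin (3 * k) → ℕ) (ha : ∀ i, s / 4 + 6 * k ≤ a i ∧ a i + 18 * k ≤ s / 2)
    (blk : V → Fin (3 * k)) (p : Fin (3 * k) → V) (hp : ∀ i, blk (p i) = i)
    (hH : ∀ v w, comp v ≠ comp (p (blk v)) → comp w = comp v → blk w = blk v)
    (hblk : ∀ i, (Finset.univ.filter (fun v => blk v = i)).card = s + a i)
    (hg : ∀ i v, blk v = i → comp v ≠ comp (p i) →
      s + a i ≤ (Finset.univ.filter (fun w => blk w = i ∧ comp w ≠ comp (p i))).card + 1 ∨
      (Finset.univ.filter (fun w => comp w = comp v)).card ≤ a i ∨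
      ((Finset.univ.filter (fun w => comp w = comp v)).card ≤ s - 2 ∧
        s - 2 ≤ (Finset.univ.filter (fun w => blk w = i ∧ comp w ≠ comp (p i))).card) ∨
      2 * (Finset.univ.filter (fun w => comp w = comp v)).card + 2 ≤ s)
    (v0 : V) (hv0 : comp v0 ≠ comp (p (blk v0)))
    (hz0 : (Finset.univ.filter (fun w => comp w = comp v0)).card = s - 2) : False := by
  classical
  set z : C → ℕ := fun c => (Finset.univ.filter (fun w => comp w = c)).card with hz
  have zpos : ∀ c, 1 ≤ z c := by
    intro c
    obtain ⟨v, rfl⟩ := hsurj c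
    exact Finset.card_pos.2 ⟨v, by simp⟩
  have hgs : ∀ g, ∑ c ∈ Finset.univ.filter (fun c => ∃ v, comp v = c ∧ lam v = g), z c = s := by
    intro g
    rw [← hgrp g]
    rw [Finset.card_eq_sum_card_fiberwise (f := comp)
      (t := Finset.univ.filter (fun c => ∃ v, comp v = c ∧ lam v = g))]
    · apply Finset.sum_congr rfl
      intro c hc
      simp only [Finset.mem_filter, Finset.mem_univ, true_and] at hc
      obtain ⟨v, rfl, rfl⟩ := hc
      simp only [hz]
      congr 1
      ext w
      simp only [Finset.mem_filter, Finset.mem_univ, true_and]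
      exact ⟨fun h => ⟨hlam _ _ h, h⟩, fun h => h.2⟩
    · intro v hv
      simp at hv ⊢
      exact ⟨v, rfl, hv⟩
  have zle : ∀ c, z c ≤ s := by
    intro c
    obtain ⟨v, rfl⟩ := hsurj c
    rw [← hgs (lam v)]
    exact Finset.single_le_sum (f := z) (fun _ _ => Nat.zero_le _) (by simp; exact ⟨v, rfl, rfl⟩)
  -- upper bound
  have hup : ∑ c : C, vv M s (z c) ≤ M * (6 * k) := by
    have hch : ∀ c, ∃ g, ∃ v, comp v = c ∧ lam v = g := by
      intro c
      obtain ⟨v, rfl⟩ := hsurj c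
      exact ⟨_, v, rfl, rfl⟩
    choose gl hgl using hch
    have hfib : ∀ g, (Finset.univ.filter (fun c => gl c = g)) =
        Finset.univ.filter (fun c => ∃ v, comp v = c ∧ lam v = g) := by
      intro g
      ext c
      simp only [Finset.mem_filter, Finset.mem_univ, true_and]
      constructor
      · rintro rfl
        exact hgl c
      · rintro ⟨v, hv, rfl⟩
        obtain ⟨w, hw, hw'⟩ := hgl c
        rw [← hw']
        exact hlam _ _ (hw.trans hv.symm)
    rw [← Finset.sum_fiberwise (s := Finset.univ) (g := gl)]
    calc _ ≤ ∑ g, M * (Finset.univ.filter (fun c => gl c = g)).card := by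
          apply Finset.sum_le_sum
          intro g _
          apply group_lemma _ z M s _ (by omega)
          rw [hfib]
          exact hgs g
      _ = M * Fintype.card C := by
          rw [← Finset.mul_sum]
          congr 1
          exact (Finset.card_eq_sum_card_fiberwise (fun _ _ => Finset.mem_coe.2 (Finset.mem_univ _))).symm
      _ ≤ _ := Nat.mul_le_mul_left _ hcard
  -- pieces
  set F : Fin (3 * k) → Finset C := fun i =>
    Finset.univ.filter (fun c => ∃ v, comp v = c ∧ blk v = i ∧ comp v ≠ comp (p i)) with hF
  have memF : ∀ i c, c ∈ F i ↔ ∃ v, comp v = c ∧ blk v = i ∧ comp v ≠ comp (p i) := by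
    intro i c; simp [hF]
  have Ftop : ∀ i j, comp (p j) ∉ F i := by
    intro i j h
    obtain ⟨v, h1, rfl, h3⟩ := (memF _ _).1 h
    have := hH v (p j) h3 h1.symm
    rw [hp] at this
    subst this
    exact h3 h1
  have Fdis : ∀ i j, i ≠ j → Disjoint (F i) (F j) := by
    intro i j hij
    rw [Finset.disjoint_left]
    intro c h1 h2
    obtain ⟨v, rfl, rfl, h3⟩ := (memF _ _).1 h1
    obtain ⟨w, h4, rfl, h6⟩ := (memF _ _).1 h2
    exact hij (hH v w h3 h4).symm
  have hD : ∀ i, ∑ c ∈ F i, z c =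
      (Finset.univ.filter (fun w => blk w = i ∧ comp w ≠ comp (p i))).card := by
    intro i
    rw [Finset.card_eq_sum_card_fiberwise (f := comp) (t := F i)]
    · apply Finset.sum_congr rfl
      intro c hc
      obtain ⟨v, rfl, rfl, h3⟩ := (memF _ _).1 hc
      simp only [hz]
      congr 1
      ext w
      simp only [Finset.mem_filter, Finset.mem_univ, true_and]
      exact ⟨fun h => ⟨⟨hH v w h3 h, h ▸ h3⟩, h⟩, fun h => h.2⟩
    · intro v hv
      have hv' := (Finset.mem_filter.1 (Finset.mem_coe.1 hv)).2
      exact Finset.mem_coe.2 ((memF _ _).2 ⟨v, rfl, hv'⟩)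
  set t : Fin (3 * k) → ℕ := fun i =>
    (Finset.univ.filter (fun w => blk w = i ∧ comp w = comp (p i))).card with ht
  have htD : ∀ i, t i + ∑ c ∈ F i, z c = s + a i := by
    intro i
    have := Finset.card_filter_add_card_filter_not
      (s := Finset.univ.filter (fun v => blk v = i)) (fun w => comp w = comp (p i))
    rw [Finset.filter_filter, Finset.filter_filter] at this
    rw [hD, ← hblk i, ← this]
  have tz : ∀ i, t i ≤ z (comp (p i)) := by
    intro i
    apply Finset.card_le_card
    intro w
    simp
  set B : Fin (3 * k) → ℕ := fun i => ∑ c ∈ F i, vv M s (z c) with hB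
  have hclass : ∀ i, 2 * M ≤ B i ∨ (2 * M ≤ B i + 2 ∧ a i + 3 ≤ t i + M) ∨
      (M ≤ B i ∧ s / 2 + a i + 2 ≤ t i + M) := by
    intro i
    apply block_lemma (F i) z k s M (a i) (t i) hM hk hs hs4 (ha i).1 (ha i).2 (htD i).ge
      ((tz i).trans (zle _)) (fun c _ => zle c) _ (htD i).le
    intro c hc
    obtain ⟨v, rfl, h2, h3⟩ := (memF _ _).1 hc
    rw [hD]
    exact hg i v h2 h3
  set i0 := blk v0 with hi0
  have hex := block_lemma_exact (F i0) z k s M (a i0) (t i0) hM hk hs (htD i0).ge (comp v0)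
    ((memF _ _).2 ⟨v0, rfl, rfl, hv0⟩) hz0
  set Tops : Finset C := Finset.univ.image (fun i => comp (p i)) with hT
  have htop : ∀ c ∈ Tops, _ := fun c (hc : c ∈ Tops) =>
    top_lemma (Finset.univ.filter (fun i => comp (p i) = c)) t B a k s M (z c) hM hk hs hs4
      (fun i => (ha i).1) (by
        simp only [hz]
        rw [Finset.card_eq_sum_card_fiberwise (f := blk) (t := Finset.univ)
          (fun _ _ => Finset.mem_coe.2 (Finset.mem_univ _))]
        refine le_trans (Finset.sum_le_sum (fun i hi => ?_)) (Finset.sum_le_sum_of_subset (Finset.subset_univ _))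
        apply Finset.card_le_card
        intro w
        have := (Finset.mem_filter.1 hi).2
        subst this
        simp only [Finset.mem_filter, Finset.mem_univ, true_and]
        tauto) (zle c) (zpos c) (by
        refine le_trans (Finset.card_le_univ _) ?_
        simp) (fun i _ => hclass i)
  have hlow : ∑ c ∈ Tops, (2 * M * (Finset.univ.filter (fun i => comp (p i) = c)).card) <
      ∑ c ∈ Tops, (vv M s (z c) + ∑ i ∈ Finset.univ.filter (fun i => comp (p i) = c), B i) := by
    have hmem : comp (p i0) ∈ Tops := Finset.mem_image_of_mem _ (Finset.mem_univ _)
    apply Finset.sum_lt_sum (fun c hc => (htop c hc).1)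
    exact ⟨_, hmem, (htop _ hmem).2 i0 (by simp) hex⟩
  have hmaps : ∀ i ∈ (Finset.univ : Finset (Fin (3 * k))), comp (p i) ∈ Tops :=
    fun i _ => Finset.mem_image_of_mem _ (Finset.mem_univ _)
  rw [← Finset.mul_sum, ← Finset.card_eq_sum_card_fiberwise hmaps, Finset.sum_add_distrib,
    Finset.sum_fiberwise_of_maps_to hmaps] at hlow
  simp only [Finset.card_univ, Fintype.card_fin] at hlow
  have hBs : ∑ i, B i = ∑ c ∈ Finset.univ.biUnion F, vv M s (z c) := by
    rw [Finset.sum_biUnion]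
    intro i _ j _ hij
    exact Fdis i j hij
  have hd : Disjoint Tops (Finset.univ.biUnion F) := by
    rw [Finset.disjoint_left]
    intro c hc hc'
    obtain ⟨j, _, rfl⟩ := Finset.mem_image.1 hc
    obtain ⟨i, _, hi⟩ := Finset.mem_biUnion.1 hc'
    exact Ftop i j hi
  rw [hBs, ← Finset.sum_union hd] at hlow
  have := Finset.sum_le_sum_of_subset (f := fun c => vv M s (z c))
    (Finset.subset_univ (Tops ∪ Finset.univ.biUnion F))
  have e : 2 * M * (3 * k) = M * (6 * k) := by ring
  omega

lemma card_comps {V : Type} [Finite V] (G : SimpleGraph V) (EP : Set (Sym2 V)) (d : V → ℕ)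
    (h0 : ∀ u v, d u = 0 → d v = 0 → u = v)
    (hpar : ∀ u, d u ≠ 0 → ∃ w, G.Adj u w ∧ d w < d u) :
    Nat.card (G.deleteEdges EP).ConnectedComponent ≤ EP.ncard + 1 := by
  classical
  have hmin : ∀ c : (G.deleteEdges EP).ConnectedComponent,
      ∃ u, (G.deleteEdges EP).connectedComponentMk u = c ∧
        ∀ w, (G.deleteEdges EP).connectedComponentMk w = c → d u ≤ d w := by
    intro c
    have hne : {u | (G.deleteEdges EP).connectedComponentMk u = c}.Nonempty := by
      obtain ⟨v, hv⟩ := c.exists_rep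
      exact ⟨v, hv⟩
    obtain ⟨u, hu, hu'⟩ := Set.exists_min_image _ d (Set.toFinite _) hne
    exact ⟨u, hu, hu'⟩
  choose u hu hu' using hmin
  choose! π hπ hπ' using hpar
  have hcut : ∀ c, d (u c) ≠ 0 → s(u c, π (u c)) ∈ EP := by
    intro c hc
    by_contra hn
    have hadj : (G.deleteEdges EP).Adj (u c) (π (u c)) := by
      rw [SimpleGraph.deleteEdges_adj]
      exact ⟨hπ _ hc, hn⟩
    have h1 : (G.deleteEdges EP).connectedComponentMk (π (u c)) = c := by
      rw [← SimpleGraph.ConnectedComponent.sound hadj.reachable, hu c]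
    have := hu' c _ h1
    have := hπ' _ hc
    omega
  have hinj : ∀ c c', u c = u c' → c = c' := by
    intro c c' h
    rw [← hu c, ← hu c', h]
  let f : (G.deleteEdges EP).ConnectedComponent → Option EP := fun c =>
    if h : d (u c) = 0 then none else some ⟨_, hcut c h⟩
  have hf : Function.Injective f := by
    intro c c' h
    apply hinj
    simp only [f] at h
    split_ifs at h with h1 h2 h2
    · exact h0 _ _ h1 h2
    · simp only [Option.some.injEq, Subtype.mk.injEq, Sym2.eq_iff] at h
      rcases h with h | h
      · exact h.1
      · have e1 := hπ' _ h1
        have e2 := hπ' _ h2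
        rw [h.2] at e1
        rw [← h.1] at e2
        omega
  have := Nat.card_le_card_of_injective f hf
  rw [Finite.card_option] at this
  exact this

lemma exit_lemma {V : Type} {G : SimpleGraph V} (S A B : V → Prop)
    (h : ∀ x y, S x → ¬ S y → G.Adj x y → A x ∧ B y) {x y : V} (hx : S x) (hy : ¬ S y)
    (hr : G.Reachable x y) : (∃ u, A u ∧ G.Reachable x u) ∧ ∃ w, B w ∧ G.Reachable x w := by
  obtain ⟨p⟩ := hr
  induction p with
  | nil => exact absurd hx hy
  | @cons a b c hab q ih =>
    by_cases hb : S b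
    · obtain ⟨⟨u, hu, hu'⟩, w, hw, hw'⟩ := ih hb hy
      exact ⟨⟨u, hu, hab.reachable.trans hu'⟩, w, hw, hab.reachable.trans hw'⟩
    · obtain ⟨h1, h2⟩ := h _ _ hx hb hab
      exact ⟨⟨a, h1, SimpleGraph.Reachable.refl _⟩, b, h2, hab.reachable⟩

/-- The set of positions. -/
def RBT.pos : RBT → Finset (List Bool)
  | .nil => ∅
  | .node l r => insert [] ((l.pos.image (List.cons false)) ∪ (r.pos.image (List.cons true)))

lemma RBT.mem_pos : ∀ (t : RBT) (l : List Bool), l ∈ t.pos ↔ t.Valid l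
  | .nil, _ => by simp [RBT.pos, RBT.Valid]
  | .node _ _, [] => by simp [RBT.pos, RBT.Valid]
  | .node l _, (false :: bs) => by simp [RBT.pos, RBT.Valid, RBT.mem_pos l bs]
  | .node _ r, (true :: bs) => by simp [RBT.pos, RBT.Valid, RBT.mem_pos r bs]

lemma RBT.card_pos (t : RBT) : t.pos.card = t.size := by
  induction t with
  | nil => simp [RBT.pos, RBT.size]
  | node l r hl hr =>
    rw [RBT.pos, RBT.size, Finset.card_insert_of_notMem (by simp), Finset.card_union_of_disjoint,
      Finset.card_image_of_injective _ (List.cons_injective),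
      Finset.card_image_of_injective _ (List.cons_injective), hl, hr]
    rw [Finset.disjoint_left]
    intro x h1 h2
    simp only [Finset.mem_image] at h1 h2
    obtain ⟨y, _, rfl⟩ := h1
    obtain ⟨z, _, h⟩ := h2
    simp at h

instance RBT.fintypeValid (t : RBT) : Finite {l : List Bool // t.Valid l} :=
  Set.Finite.to_subtype (s := {l | t.Valid l})
    (Set.Finite.subset t.pos.finite_toSet (fun l hl => Finset.mem_coe.2 ((t.mem_pos l).2 hl)))

/-- Subtree at a position. -/
def RBT.sub : RBT → List Bool → RBT
  | t, [] => t
  | .nil, _ :: _ => .nil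
  | .node l _, (false :: bs) => RBT.sub l bs
  | .node _ r, (true :: bs) => RBT.sub r bs

lemma RBT.valid_append : ∀ (q : List Bool) (t : RBT) (l : List Bool),
    t.Valid (q ++ l) ↔ (t.sub q).Valid l
  | [], t, l => by cases t <;> simp [RBT.sub]
  | _ :: _, .nil, l => by simp [RBT.sub, RBT.Valid]
  | false :: bs, .node t _, l => by simp [RBT.sub, RBT.Valid, RBT.valid_append bs t l]
  | true :: bs, .node _ t, l => by simp [RBT.sub, RBT.Valid, RBT.valid_append bs t l]

/-- Subtree vertex predicate. -/
def InS {k : ℕ} {Tsh : Fin (3*k) → RBT} (i : Fin (3*k)) (q : List Bool) (v : Vtx k Tsh) : Prop :=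
  ∃ x : {l : List Bool // (Tsh i).Valid l}, q <+: x.1 ∧ v = Sum.inr ⟨i, x⟩

lemma card_InS {k : ℕ} {Tsh : Fin (3*k) → RBT} [Fintype (Vtx k Tsh)] (i : Fin (3*k))
    (q : List Bool) [DecidablePred (InS (Tsh := Tsh) i q)] :
    (Finset.univ.filter (fun v : Vtx k Tsh => InS i q v)).card = ((Tsh i).sub q).size := by
  rw [← RBT.card_pos]
  symm
  apply Finset.card_bij (fun l hl => (Sum.inr ⟨i, ⟨q ++ l,
    (RBT.valid_append q (Tsh i) l).2 ((RBT.mem_pos _ _).1 hl)⟩⟩ : Vtx k Tsh))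
  · intro l hl
    simp only [Finset.mem_filter, Finset.mem_univ, true_and]
    exact ⟨_, List.prefix_append _ _, rfl⟩
  · intro l hl l' hl' h
    simpa using h
  · intro v hv
    obtain ⟨⟨x, hx⟩, ⟨l, rfl⟩, rfl⟩ := (Finset.mem_filter.1 hv).2
    exact ⟨l, (RBT.mem_pos _ _).2 ((RBT.valid_append _ _ _).1 hx), rfl⟩

end TP
namespace TP

lemma exit_root {k : ℕ} {Tsh : Fin (3*k) → RBT} (i : Fin (3*k)) (v w : Vtx k Tsh)
    (hv : InS i [] v) (hw : ¬ InS i [] w) (h : (TGraph k Tsh).Adj v w) :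
    (∃ x : {l : List Bool // (Tsh i).Valid l}, x.1 = [] ∧ v = Sum.inr ⟨i, x⟩) ∧
      w = Sum.inl i := by
  obtain ⟨x, _, rfl⟩ := hv
  rw [TGraph, SimpleGraph.fromRel_adj] at h
  obtain ⟨_, h⟩ := h
  rcases w with j | ⟨j, y⟩
  · simp only [false_or] at h
    obtain ⟨rfl, h⟩ := h
    exact ⟨⟨x, h, rfl⟩, rfl⟩
  · exfalso
    simp only at h
    have : i = j := by rcases h with h | h; exacts [h.1, h.1.symm]
    subst this
    exact hw ⟨y, List.nil_prefix, rfl⟩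

lemma exit_sub {k : ℕ} {Tsh : Fin (3*k) → RBT} (i : Fin (3*k)) (q : List Bool) (c : Bool)
    (v w : Vtx k Tsh)
    (hv : InS i (q ++ [c]) v) (hw : ¬ InS i (q ++ [c]) w) (h : (TGraph k Tsh).Adj v w) :
    (∃ x : {l : List Bool // (Tsh i).Valid l}, x.1 = q ++ [c] ∧ v = Sum.inr ⟨i, x⟩) ∧
    (∃ x : {l : List Bool // (Tsh i).Valid l}, x.1 = q ∧ w = Sum.inr ⟨i, x⟩) := by
  obtain ⟨x, hx, rfl⟩ := hv
  rw [TGraph, SimpleGraph.fromRel_adj] at h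
  obtain ⟨_, h⟩ := h
  rcases w with j | ⟨j, y⟩
  · simp only [false_or] at h
    rw [h.2] at hx
    simp at hx
  · simp only at h
    have : i = j := by rcases h with h | h; exacts [h.1, h.1.symm]
    subst this
    rcases h with ⟨_, b, hb⟩ | ⟨_, b, hb⟩
    · exfalso
      refine hw ⟨y, ?_, rfl⟩
      rw [hb]
      exact hx.trans (List.prefix_append _ _)
    · rw [hb, List.prefix_concat_iff] at hx
      rcases hx with hx | hx
      · refine ⟨⟨x, ?_, rfl⟩, ⟨y, ?_, rfl⟩⟩
        · rw [hb, hx]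
        · exact (List.append_inj_left' hx rfl).symm
      · exact absurd ⟨y, hx, rfl⟩ hw

end TP
namespace TP

/-- Depth. -/
def dep {k : ℕ} {Tsh : Fin (3*k) → RBT} : Vtx k Tsh → ℕ
  | Sum.inl i => i
  | Sum.inr ⟨i, x⟩ => i + 1 + x.1.length

lemma RBT.valid_prefix (t : RBT) (q l : List Bool) (h : t.Valid (q ++ l)) : t.Valid q := by
  have h' := (RBT.valid_append q t l).1 h
  have : t.Valid (q ++ []) := by
    rw [RBT.valid_append]
    cases hh : t.sub q with
    | nil => rw [hh] at h'; simp [RBT.Valid] at h'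
    | node => simp [RBT.Valid]
  simpa using this

lemma dep_zero {k : ℕ} {Tsh : Fin (3*k) → RBT} (u v : Vtx k Tsh) (hu : dep u = 0)
    (hv : dep v = 0) : u = v := by
  rcases u with i | ⟨i, x⟩ <;> rcases v with j | ⟨j, y⟩ <;> simp only [dep] at hu hv
  · congr 1
    apply Fin.ext
    omega
  all_goals omega

lemma dep_par {k : ℕ} {Tsh : Fin (3*k) → RBT} (u : Vtx k Tsh) (hu : dep u ≠ 0) :
    ∃ w, (TGraph k Tsh).Adj u w ∧ dep w < dep u := by
  rcases u with i | ⟨i, ⟨x, hx⟩⟩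
  · simp only [dep] at hu
    refine ⟨Sum.inl ⟨i - 1, by omega⟩, ?_, by simp only [dep]; omega⟩
    rw [TGraph, SimpleGraph.fromRel_adj]
    refine ⟨?_, Or.inr ?_⟩
    · intro h
      have := congrArg Fin.val (Sum.inl.inj h)
      simp only at this
      omega
    · simp only
      omega
  · rcases List.eq_nil_or_concat x with rfl | ⟨y, c, rfl⟩
    · refine ⟨Sum.inl i, ?_, by simp [dep]⟩
      rw [TGraph, SimpleGraph.fromRel_adj]
      exact ⟨by simp, Or.inr ⟨rfl, rfl⟩⟩
    · simp only [List.concat_eq_append] at hx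
      refine ⟨Sum.inr ⟨i, ⟨y, RBT.valid_prefix _ _ _ hx⟩⟩, ?_, by simp [dep]⟩
      rw [TGraph, SimpleGraph.fromRel_adj]
      exact ⟨by simp, Or.inr ⟨rfl, c, by simp⟩⟩

/-- Block index. -/
def bk {k : ℕ} {Tsh : Fin (3*k) → RBT} : Vtx k Tsh → Fin (3*k)
  | Sum.inl i => i
  | Sum.inr ⟨i, _⟩ => i

lemma bk_iff {k : ℕ} {Tsh : Fin (3*k) → RBT} (i : Fin (3*k)) (v : Vtx k Tsh) :
    bk v = i ↔ v = Sum.inl i ∨ InS i [] v := by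
  rcases v with j | ⟨j, x⟩
  · simp [bk, InS]
  · simp only [bk, InS]
    constructor
    · rintro rfl
      exact Or.inr ⟨x, List.nil_prefix, rfl⟩
    · rintro (h | ⟨y, _, h⟩)
      · simp at h
      · simp only [Sum.inr.injEq, Sigma.mk.injEq] at h
        exact h.1

lemma nice_half (t : RBT) (s : ℕ) (hs : 4 ∣ s) (hs' : 4 ≤ s) (h : t.IsNice)
    (hsz : t.size = s - 2) (c : Bool) : 2 * (t.sub [c]).size + 2 ≤ s := by
  cases t with
  | nil => simp only [RBT.size] at hsz; omega
  | node l r =>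
    simp only [RBT.size] at hsz
    have h3 := h.2.2
    simp only [Nat.dist] at h3
    cases c
    · have : (RBT.node l r).sub [false] = l := by simp [RBT.sub]
      rw [this]; omega
    · have : (RBT.node l r).sub [true] = r := by simp [RBT.sub]
      rw [this]; omega

end TP

open TP

/-- For every solution `P` of the instance `(T, 6k−1, 4k)` and every `i`,
the subtree `R_i` is not a `P`-component. -/
theorem statement1
    (k s : ℕ) (hk : 1 ≤ k) (hs4 : 4 ∣ s) (hs : 24 * k < s)
    (a : Fin (3*k) → ℕ) (ha : ∀ i, s / 4 + 6 * k ≤ a i ∧ a i ≤ s / 2 - 18 * k)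
    (Lsh Rsh : Fin (3*k) → RBT)
    (hL : ∀ i, (Lsh i).IsNice ∧ (Lsh i).size = a i)
    (hR : ∀ i, (Rsh i).IsNice ∧ (Rsh i).size = s - 2)
    (EP : Set (Sym2 (Vtx k (nodes Lsh Rsh)))) (lam : Vtx k (nodes Lsh Rsh) → Fin (4*k))
    (hP : IsSolutionEq (TGraph k (nodes Lsh Rsh)) EP (6*k - 1) (4*k) (fun _ => s) lam)
    (i : Fin (3*k)) :
    ¬ IsPComp (TGraph k (nodes Lsh Rsh)) EP (RiSet k (nodes Lsh Rsh) i) := by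
  classical
  generalize hT : nodes Lsh Rsh = Tsh at EP lam hP ⊢
  rintro ⟨v0, hv0⟩
  obtain ⟨_, hP2, hP3, hP4⟩ := hP
  have hs96 : 96 * k ≤ s := by have := ha i; omega
  have ha' : ∀ i, s / 4 + 6 * k ≤ a i ∧ a i + 18 * k ≤ s / 2 := by
    intro i; have := ha i; omega
  set G := (TGraph k Tsh).deleteEdges EP with hG
  have : Finite (Vtx k Tsh) := inferInstance
  have : Fintype (Vtx k Tsh) := Fintype.ofFinite _
  have : Fintype G.ConnectedComponent := Fintype.ofFinite _
  have hGle : ∀ {x y}, G.Adj x y → (TGraph k Tsh).Adj x y := fun h =>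
    (SimpleGraph.deleteEdges_le EP) h
  have eqR : ∀ x y, G.connectedComponentMk x = G.connectedComponentMk y ↔ G.Reachable x y :=
    fun x y => SimpleGraph.ConnectedComponent.eq
  have uniq : ∀ (j : Fin (3*k)) (q : List Bool) (u v : Vtx k Tsh),
      (∃ x : {l : List Bool // (Tsh j).Valid l}, x.1 = q ∧ u = Sum.inr ⟨j, x⟩) →
      (∃ x : {l : List Bool // (Tsh j).Valid l}, x.1 = q ∧ v = Sum.inr ⟨j, x⟩) → u = v := by
    rintro j q _ _ ⟨⟨x, hx⟩, rfl, rfl⟩ ⟨⟨y, hy⟩, h, rfl⟩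
    simp only at h
    subst h
    rfl
  -- exits
  have ex0 : ∀ (j : Fin (3*k)) (x y : Vtx k Tsh), InS j [] x → ¬ InS j [] y → G.Reachable x y →
      (∃ u, (∃ x : {l : List Bool // (Tsh j).Valid l}, x.1 = [] ∧ u = Sum.inr ⟨j, x⟩) ∧
        G.Reachable x u) ∧ G.Reachable x (Sum.inl j) := by
    intro j x y hx hy hr
    obtain ⟨h1, w, rfl, h2⟩ := exit_lemma (G := G) (InS j []) _ (fun w => w = Sum.inl j)
      (fun x y h1 h2 h3 => exit_root j x y h1 h2 (hGle h3)) hx hy hr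
    exact ⟨h1, h2⟩
  have ex1 : ∀ (j : Fin (3*k)) (q : List Bool) (c : Bool) (x y : Vtx k Tsh),
      InS j (q ++ [c]) x → ¬ InS j (q ++ [c]) y → G.Reachable x y →
      (∃ u, (∃ x : {l : List Bool // (Tsh j).Valid l}, x.1 = q ++ [c] ∧ u = Sum.inr ⟨j, x⟩) ∧
        G.Reachable x u) ∧
      (∃ u, (∃ x : {l : List Bool // (Tsh j).Valid l}, x.1 = q ∧ u = Sum.inr ⟨j, x⟩) ∧
        G.Reachable x u) := by
    intro j q c x y hx hy hr
    exact exit_lemma (G := G) (InS j (q ++ [c])) _ _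
      (fun x y h1 h2 h3 => exit_sub j q c x y h1 h2 (hGle h3)) hx hy hr
  have notinl : ∀ (j : Fin (3*k)) (q : List Bool) (l : Fin (3*k)),
      ¬ InS j q (Sum.inl l : Vtx k Tsh) := by
    rintro j q l ⟨x, _, h⟩
    simp at h
  have inroot : ∀ (j : Fin (3*k)) (q : List Bool) (v : Vtx k Tsh), InS j q v → InS j [] v := by
    rintro j q v ⟨x, _, h⟩
    exact ⟨x, List.nil_prefix, h⟩
  -- sizes
  have sz0 : ∀ j, (Finset.univ.filter (fun v : Vtx k Tsh => InS j [] v)).card + 1 = s + a j := by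
    intro j
    rw [card_InS]
    have : ((Tsh j).sub []).size = (Lsh j).size + (Rsh j).size + 1 := by
      simp [RBT.sub, ← hT, nodes, RBT.size]
    rw [this, (hL j).2, (hR j).2]
    omega
  have szL : ∀ j, (Finset.univ.filter (fun v : Vtx k Tsh => InS j [false] v)).card = a j := by
    intro j
    rw [card_InS]
    have : ((Tsh j).sub [false]) = Lsh j := by
      simp [RBT.sub, ← hT, nodes]
    rw [this, (hL j).2]
  have szR : ∀ j, (Finset.univ.filter (fun v : Vtx k Tsh => InS j [true] v)).card = s - 2 := by
    intro j
    rw [card_InS]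
    have : ((Tsh j).sub [true]) = Rsh j := by
      simp [RBT.sub, ← hT, nodes]
    rw [this, (hR j).2]
  have szRc : ∀ j c,
      2 * (Finset.univ.filter (fun v : Vtx k Tsh => InS j [true, c] v)).card + 2 ≤ s := by
    intro j c
    rw [card_InS]
    have : ((Tsh j).sub [true, c]) = (Rsh j).sub [c] := by
      simp [RBT.sub, ← hT, nodes]
    rw [this]
    exact nice_half _ s hs4 (by omega) (hR j).1 (hR j).2 c
  -- the exact component
  have hRi : ∀ w, InS i [true] w ↔ G.Reachable v0 w := by
    intro w
    have h1 : w ∈ RiSet k Tsh i ↔ G.Reachable v0 w := by rw [hv0]; rfl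
    rw [← h1]
    constructor
    · rintro ⟨x, ⟨l, hl⟩, rfl⟩
      exact ⟨x, by rw [← hl]; rfl, rfl⟩
    · rintro ⟨x, hx, rfl⟩
      refine ⟨x, ?_, rfl⟩
      obtain ⟨l, hl⟩ := List.head?_eq_some_iff.1 hx
      exact ⟨l, by rw [hl]; rfl⟩
  have hv0S : InS i [true] v0 := (hRi v0).2 (SimpleGraph.Reachable.refl _)
  have hbv0 : bk v0 = i := (bk_iff i v0).2 (Or.inr (inroot _ _ _ hv0S))
  refine core (fun v => G.connectedComponentMk v) (fun c => c.exists_rep) k s (6 * k + 1) rfl hk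
    hs96 hs4 ?_ lam ?_ ?_ a ha' bk (fun j => Sum.inl j) (fun j => rfl) ?_ ?_ ?_ v0 ?_ ?_
  · have := card_comps (TGraph k Tsh) EP dep dep_zero dep_par
    rw [hP2] at this
    rw [← Nat.card_eq_fintype_card]
    exact this.trans (by omega)
  · intro v w h
    exact hP3 v w ((eqR v w).1 h)
  · intro g
    have h4 := hP4 g
    simp only at h4
    rw [← h4, Set.ncard_eq_toFinset_card']
    congr 1
    ext v
    simp
  · intro v w h1 h2
    simp only [ne_eq, eqR] at h1 h2
    rcases (bk_iff (bk v) v).1 rfl with h | h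
    · exact absurd (h ▸ SimpleGraph.Reachable.refl _) h1
    · rw [bk_iff]
      right
      by_contra hn
      exact h1 (ex0 _ v w h hn h2.symm).2
  · intro j
    rw [← sz0 j]
    have : (Finset.univ.filter (fun v : Vtx k Tsh => bk v = j)) =
        insert (Sum.inl j) (Finset.univ.filter (fun v : Vtx k Tsh => InS j [] v)) := by
      ext v
      simp [bk_iff]
    rw [this, Finset.card_insert_of_notMem]
    simp only [Finset.mem_filter, not_and]
    exact fun _ => notinl _ _ _
  · intro j v hv hvp
    simp only [ne_eq, eqR] at hvp ⊢
    have hvS : InS j [] v := by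
      rcases (bk_iff j v).1 hv with h | h
      · exact absurd (h ▸ SimpleGraph.Reachable.refl _) hvp
      · exact h
    have hroot : ∀ q, (∀ w, InS j q w → ¬ G.Reachable w (Sum.inl j)) →
        (Finset.univ.filter (fun v : Vtx k Tsh => InS j q v)).card ≤
        (Finset.univ.filter (fun w => bk w = j ∧ ¬ G.Reachable w (Sum.inl j))).card := by
      intro q hq
      apply Finset.card_le_card
      intro w hw
      have hw' := (Finset.mem_filter.1 hw).2
      simp only [Finset.mem_filter, Finset.mem_univ, true_and]
      exact ⟨(bk_iff j w).2 (Or.inr (inroot _ _ _ hw')), hq w hw'⟩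
    have hsub : ∀ q, (∀ w, G.Reachable w v → InS j q w) →
        (Finset.univ.filter (fun w => G.Reachable w v)).card ≤
        (Finset.univ.filter (fun v : Vtx k Tsh => InS j q v)).card := by
      intro q hq
      apply Finset.card_le_card
      intro w hw
      have hw' := (Finset.mem_filter.1 hw).2
      simp only [Finset.mem_filter, Finset.mem_univ, true_and]
      exact hq w hw'
    by_cases h1 : ∃ u, (∃ x : {l : List Bool // (Tsh j).Valid l}, x.1 = [] ∧
        u = Sum.inr ⟨j, x⟩) ∧ G.Reachable v u
    · left
      obtain ⟨u, hu, hvu⟩ := h1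
      have := hroot [] (by
        intro w hw hwr
        obtain ⟨⟨u', hu', hwu'⟩, _⟩ := ex0 j w _ hw (notinl j [] j) hwr
        have := uniq j [] u u' hu hu'
        subst this
        exact hvp (hvu.trans (hwu'.symm.trans hwr)))
      have := sz0 j
      omega
    · right
      have hin : ∀ c, InS j [c] v → ∀ w, G.Reachable w v → InS j [c] w := by
        intro c hc w hw
        by_contra hn
        exact h1 (ex1 j [] c v w hc hn hw.symm).2
      have hc : ∃ c, InS j [c] v := by
        obtain ⟨⟨x, hx⟩, _, rfl⟩ := hvS
        cases x with
        | nil => exact absurd ⟨_, ⟨⟨[], hx⟩, rfl, rfl⟩, SimpleGraph.Reachable.refl _⟩ h1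
        | cons c l => exact ⟨c, ⟨c :: l, hx⟩, ⟨l, rfl⟩, rfl⟩
      obtain ⟨c, hc⟩ := hc
      have hle := hsub [c] (hin c hc)
      cases c with
      | false =>
        left
        rw [szL] at hle
        exact hle
      | true =>
        right
        rw [szR] at hle
        by_cases h2 : ∃ u, (∃ x : {l : List Bool // (Tsh j).Valid l}, x.1 = [true] ∧
            u = Sum.inr ⟨j, x⟩) ∧ G.Reachable v u
        · left
          refine ⟨hle, ?_⟩
          obtain ⟨u, hu, hvu⟩ := h2
          rw [← szR j]
          apply hroot
          intro w hw hwr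
          obtain ⟨⟨u', hu', hwu'⟩, _⟩ := ex1 j [] true w _ hw (notinl j _ j) hwr
          have := uniq j [true] u u' hu hu'
          subst this
          exact hvp (hvu.trans (hwu'.symm.trans hwr))
        · right
          have hc' : ∃ c, InS j [true, c] v := by
            obtain ⟨⟨x, hx⟩, ⟨l, hl⟩, rfl⟩ := hc
            simp only at hl
            subst hl
            cases l with
            | nil => exact absurd ⟨_, ⟨⟨_, hx⟩, rfl, rfl⟩, SimpleGraph.Reachable.refl _⟩ h2
            | cons c l => exact ⟨c, ⟨_, hx⟩, ⟨l, rfl⟩, rfl⟩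
          obtain ⟨c', hc'⟩ := hc'
          have hle' := hsub [true, c'] (by
            intro w hw
            by_contra hn
            exact h2 (ex1 j [true] c' v w hc' hn hw.symm).2)
          have := szRc j c'
          omega
  · simp only [ne_eq, eqR]
    intro h
    exact notinl _ _ _ ((hRi _).2 h)
  · simp only [eqR]
    rw [← szR i]
    congr 1
    ext w
    simp only [Finset.mem_filter, Finset.mem_univ, true_and]
    rw [hRi]
    exact ⟨fun h => h.symm, fun h => h.symm⟩
end
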